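/- arXiv:2411.09416 — 11 statements merged into one kernel-verified Lean document; each statement's English description precedes it below -/
import Mathlib

section
/- Let R be an n-ΔU ring and let k be a positive integer such that n divides k. Then R is a k-ΔU ring. -/
/-- `Δ(R)`: the set of elements `a` such that `1 - ua` is a unit for every unit `u`. -/
def Delta (R : Type*) [Ring R] : Set R :=
  {a : R | ∀ u : Rˣ, IsUnit (1 - (u : R) * a)}

/-- A ring `R` is `n`-ΔU if `uⁿ - 1 ∈ Δ(R)` for every unit `u` of `R`. -/
def IsNDeltaU (R : Type*) [Ring R] (n : ℕ) : Prop :=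
  ∀ u : Rˣ, ((u : R) ^ n - 1) ∈ Delta R

theorem isNDeltaU_of_dvd (R : Type*) [Ring R] (n k : ℕ) (hn : 1 ≤ n) (hk : 1 ≤ k)
    (hdvd : n ∣ k) (h : IsNDeltaU R n) :
    IsNDeltaU R k := by
  obtain ⟨m, rfl⟩ := hdvd
  intro u
  simpa only [Units.val_pow_eq_pow_val, ← pow_mul, mul_comm m n] using h (u ^ m)
end

section
/- Let F be a field and n ≥ 1 a fixed integer. Then F is n-ΔU if and only if F is finite and (|F| − 1) divides n. -/
theorem Delta_field (F : Type*) [Field F] : Delta F = {0} := by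
  ext a
  simp only [Delta, Set.mem_ofPred_eq, Set.mem_singleton_iff]
  refine ⟨fun h => ?_, fun h u => by simp [h]⟩
  by_contra ha
  simpa [ha] using h (Units.mk0 a ha)⁻¹

theorem isNDeltaU_field_iff_units_pow_eq_one (F : Type*) [Field F] (n : ℕ) :
    IsNDeltaU F n ↔ ∀ u : Fˣ, u ^ n = 1 := by
  simp only [IsNDeltaU, Delta_field, Set.mem_singleton_iff, sub_eq_zero, Units.ext_iff,
    Units.val_pow_eq_pow_val, Units.val_one]

theorem finite_of_units_pow_eq_one (F : Type*) [Field F] {n : ℕ} (hn : 0 < n)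
    (h : ∀ u : Fˣ, u ^ n = 1) : Finite F := by
  classical
  refine Set.finite_univ_iff.mp
    ((insert 0 (Polynomial.nthRootsFinset n (1 : F))).finite_toSet.subset fun x _ => ?_)
  rcases eq_or_ne x 0 with rfl | hx
  · simp
  · have hxn : x ^ n = 1 := by simpa [Units.ext_iff] using h (Units.mk0 x hx)
    simp [Polynomial.mem_nthRootsFinset hn, hxn]

theorem units_pow_eq_one_iff_card_sub_one_dvd (F : Type*) [Field F] [Finite F] (n : ℕ) :
    (∀ u : Fˣ, u ^ n = 1) ↔ (Nat.card F - 1) ∣ n := by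
  rw [← Monoid.exponent_dvd_iff_forall_pow_eq_one, IsCyclic.exponent_eq_card, Nat.card_units]

theorem field_isNDeltaU_iff (F : Type*) [Field F] (n : ℕ) (hn : 1 ≤ n) :
    IsNDeltaU F n ↔ (Finite F ∧ (Nat.card F - 1) ∣ n) := by
  rw [isNDeltaU_field_iff_units_pow_eq_one]
  constructor
  · intro h
    have hF : Finite F := finite_of_units_pow_eq_one F hn h
    exact ⟨hF, (units_pow_eq_one_iff_card_sub_one_dvd F n).mp h⟩
  · rintro ⟨hF, h⟩
    exact (units_pow_eq_one_iff_card_sub_one_dvd F n).mpr h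
end

section
/- Let D be a division ring and n ≥ 2 a fixed integer. If D is n-ΔU, then D is commutative (hence a field), D is finite, and (|D| − 1) divides n. -/
open Polynomial in
theorem FiniteField.prod_X_sub_C_eq (K : Type*) [Field K] [Fintype K] :
    ∏ c : K, (X - C c) = X ^ Fintype.card K - X := by
  have hdeg : (X : K[X]).degree < Fintype.card K := by
    rw [degree_X]
    exact_mod_cast Fintype.one_lt_card
  have hroots := FiniteField.roots_X_pow_card_sub_X K
  have := prod_multiset_X_sub_C_of_monic_of_roots_card_eq (monic_X_pow_sub hdeg)
    (by rw [hroots, FiniteField.X_pow_card_sub_X_natDegree_eq K Fintype.one_lt_card]; rfl)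
  rwa [hroots] at this

section Eigenvector

variable {K V : Type*} [Field K] [AddCommGroup V] [Module K V]

open Polynomial in
/-- If a product of factors `T - c` kills a nonzero vector, some `c` is an eigenvalue of `T`. -/
theorem exists_eigenvector_of_aeval_prod_eq_zero (T : Module.End K V) (s : Finset K) (w : V)
    (hw : w ≠ 0) (h : aeval T (∏ c ∈ s, (X - C c)) w = 0) :
    ∃ c ∈ s, ∃ v ≠ 0, T v = c • v := by
  classical
  induction s using Finset.induction_on with
  | empty => simp [hw] at h
  | insert c s hc ih =>
    by_cases hs : aeval T (∏ c ∈ s, (X - C c)) w = 0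
    · obtain ⟨d, hd, hv⟩ := ih hs
      exact ⟨d, Finset.mem_insert_of_mem hd, hv⟩
    · refine ⟨c, Finset.mem_insert_self _ _, _, hs, ?_⟩
      rw [Finset.prod_insert hc, map_mul, Module.End.mul_apply] at h
      simpa [sub_eq_zero] using h

open Polynomial in
/-- A nonzero operator over a finite field `K` with `T ^ |K| = T` has a nonzero eigenvalue. -/
theorem exists_eigenvector_of_pow_card_eq_self [Fintype K] (T : Module.End K V)
    (hT : T ^ Fintype.card K = T) (hT0 : T ≠ 0) :
    ∃ c : K, c ≠ 0 ∧ ∃ v ≠ 0, T v = c • v := by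
  classical
  obtain ⟨y, hy⟩ : ∃ y, T y ≠ 0 := by
    by_contra! h
    exact hT0 (LinearMap.ext h)
  have hzero : aeval T (∏ c ∈ Finset.univ.erase (0 : K), (X - C c)) (T y) = 0 := by
    have hprod := FiniteField.prod_X_sub_C_eq K
    rw [← Finset.prod_erase_mul _ _ (Finset.mem_univ (0 : K))] at hprod
    have := congrArg (fun f : K[X] => aeval T f y) hprod
    simpa [hT] using this
  obtain ⟨c, hc, hv⟩ := exists_eigenvector_of_aeval_prod_eq_zero T _ _ hy hzero
  exact ⟨c, Finset.ne_of_mem_erase hc, hv⟩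

end Eigenvector

theorem Subalgebra.finite_adjoin_of_subset_submonoid {F A : Type*} [Field F] [Finite F] [Ring A]
    [Algebra F A] (s : Set A) (M : Submonoid A) (hs : s ⊆ M) (hM : (M : Set A).Finite) :
    Finite (Algebra.adjoin F s) := by
  have hfg : (Subalgebra.toSubmodule (Algebra.adjoin F s)).FG := by
    rw [Algebra.adjoin_eq_span]
    exact Submodule.fg_span (hM.subset (Submonoid.closure_le.mpr hs))
  have : Module.Finite F (Algebra.adjoin F s) := Module.Finite.of_fg hfg
  exact Module.finite_of_finite F

theorem Subalgebra.commute_of_finite {F D : Type*} [Field F] [DivisionRing D] [Algebra F D]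
    (S : Subalgebra F D) [Finite S] {x y : D} (hx : x ∈ S) (hy : y ∈ S) : x * y = y * x :=
  congrArg Subtype.val ((Finite.isDomain_to_isField S).mul_comm ⟨x, hx⟩ ⟨y, hy⟩)

/-- If the image `a` of an element of a finite field under a ring homomorphism is not central,
then the commutator map `y ↦ a * y - y * a` has a nonzero eigenvalue. -/
theorem RingHom.exists_commutator_eq_mul {K A : Type*} [Field K] [_root_.Finite K] [Ring A]
    (φ : K →+* A) {α : K} {b : A} (hb : φ α * b ≠ b * φ α) :
    ∃ c : K, c ≠ 0 ∧ ∃ x ≠ 0, φ α * x - x * φ α = φ c * x := by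
  have : Nontrivial A := ⟨_, _, hb⟩
  let : Module K A := Module.compHom A φ
  let : Fintype K := Fintype.ofFinite K
  obtain ⟨p, hp⟩ := CharP.exists K
  obtain ⟨m, hprime, hm⟩ := FiniteField.card K p
  have : Fact p.Prime := ⟨hprime⟩
  have : CharP (Module.End K A) p :=
    charP_of_injective_algebraMap (algebraMap K (Module.End K A)).injective p
  let R : Module.End K A :=
    { toFun := fun y => y * φ α
      map_add' := fun y z => add_mul y z (φ α)
      map_smul' := fun c y => mul_assoc (φ c) y (φ α) }
  let T : Module.End K A := algebraMap K (Module.End K A) α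
  have hT (y : A) : T y = φ α * y := rfl
  have hR (y : A) : R y = y * φ α := rfl
  have hRpow (k : ℕ) (y : A) : (R ^ k) y = y * φ α ^ k := by
    induction k with
    | zero => simp
    | succ k ih => rw [pow_succ', Module.End.mul_apply, ih, hR, mul_assoc, pow_succ]
  have hαcard : α ^ Fintype.card K = α := FiniteField.pow_card _
  have hTcard : T ^ Fintype.card K = T := by rw [← map_pow, hαcard]
  have hRcard : R ^ Fintype.card K = R := by
    ext y
    rw [hRpow, ← map_pow, hαcard, hR]
  have hcomm : Commute T R := Algebra.commutes _ _
  have hcard : (T - R) ^ Fintype.card K = T - R := by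
    rw [hm, sub_pow_char_pow_of_commute p _ hcomm, ← hm, hTcard, hRcard]
  have hne : T - R ≠ 0 := fun h => hb <| by
    have := LinearMap.congr_fun h b
    rwa [LinearMap.sub_apply, hT, hR, LinearMap.zero_apply, sub_eq_zero] at this
  obtain ⟨c, hc, x, hx, hcx⟩ := exists_eigenvector_of_pow_card_eq_self (T - R) hcard hne
  exact ⟨c, hc, x, hx, by rwa [LinearMap.sub_apply, hT, hR] at hcx⟩

/-- In a division ring, a noncentral element `a` of a finite subalgebra `L` admits a nonzero `x`
with `a * x - x * a = c * x` for some nonzero `c` in `L`. -/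
theorem Subalgebra.exists_commutator_eq_mul {F D : Type*} [Field F] [DivisionRing D] [Algebra F D]
    (L : Subalgebra F D) [Finite L] {a b : D} (ha : a ∈ L) (hab : a * b ≠ b * a) :
    ∃ c ∈ L, c ≠ 0 ∧ ∃ x ≠ 0, a * x - x * a = c * x := by
  let : Field L := (Finite.isDomain_to_isField L).toField
  let φ : L →+* D := L.val.toRingHom
  obtain ⟨c, hc, x, hx, hcx⟩ := φ.exists_commutator_eq_mul (α := ⟨a, ha⟩) hab
  exact ⟨c, c.2, fun h => hc (Subtype.ext h), x, hx, hcx⟩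

theorem mul_comm_of_forall_pow_eq_one_of_charP {D : Type*} [DivisionRing D] (p : ℕ)
    [Fact p.Prime] [CharP D p] {n : ℕ} (hn : 0 < n) (h : ∀ u : D, u ≠ 0 → u ^ n = 1)
    (a b : D) : a * b = b * a := by
  by_contra hab
  let : Algebra (ZMod p) D := ZMod.algebra D p
  have ha0 : a ≠ 0 := by
    rintro rfl
    simp at hab
  have hpowers (u : D) (hu : u ≠ 0) : (Submonoid.powers u : Set D).Finite :=
    (isOfFinOrder_iff_pow_eq_one.mpr ⟨n, hn, h u hu⟩).finite_powers
  let L := Algebra.adjoin (ZMod p) {a}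
  have haL : a ∈ L := Algebra.subset_adjoin rfl
  have : Finite L := Subalgebra.finite_adjoin_of_subset_submonoid {a} (Submonoid.powers a)
    (by simp) (hpowers a ha0)
  obtain ⟨c, hcL, hc, x, hx, hcx⟩ := L.exists_commutator_eq_mul haL hab
  have hxa : x * a = (a - c) * x := by
    rw [sub_mul, ← hcx, sub_sub_cancel]
  have hxL (l : D) (hl : l ∈ L) : ∃ l' ∈ L, x * l = l' * x := by
    induction hl using Algebra.adjoin_induction with
    | mem y hy =>
      rw [Set.mem_singleton_iff.mp hy]
      exact ⟨a - c, sub_mem haL hcL, hxa⟩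
    | algebraMap r => exact ⟨_, L.algebraMap_mem r, (Algebra.commutes r x).symm⟩
    | add y z _ _ hy hz =>
      obtain ⟨y', hy', hy⟩ := hy
      obtain ⟨z', hz', hz⟩ := hz
      exact ⟨y' + z', add_mem hy' hz', by rw [mul_add, hy, hz, add_mul]⟩
    | mul y z _ _ hy hz =>
      obtain ⟨y', hy', hy⟩ := hy
      obtain ⟨z', hz', hz⟩ := hz
      exact ⟨y' * z', mul_mem hy' hz', by rw [← mul_assoc, hy, mul_assoc, hz, mul_assoc]⟩
  have hxpowL (k : ℕ) (l : D) (hl : l ∈ L) : ∃ l' ∈ L, x ^ k * l = l' * x ^ k := by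
    induction k generalizing l with
    | zero => exact ⟨l, hl, by simp⟩
    | succ k ih =>
      obtain ⟨l₁, hl₁, h₁⟩ := hxL l hl
      obtain ⟨l₂, hl₂, h₂⟩ := ih l₁ hl₁
      exact ⟨l₂, hl₂, by rw [pow_succ, mul_assoc, h₁, ← mul_assoc, h₂, mul_assoc]⟩
  let M : Submonoid D :=
    { carrier := Set.image2 (· * ·) L (Submonoid.powers x)
      one_mem' := ⟨1, one_mem L, 1, one_mem _, one_mul 1⟩
      mul_mem' := by
        rintro _ _ ⟨l₁, hl₁, _, ⟨i, rfl⟩, rfl⟩ ⟨l₂, hl₂, _, ⟨j, rfl⟩, rfl⟩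
        obtain ⟨l, hl, hil⟩ := hxpowL i l₂ hl₂
        refine ⟨l₁ * l, mul_mem hl₁ hl, x ^ (i + j), ⟨i + j, rfl⟩, ?_⟩
        change l₁ * l * x ^ (i + j) = l₁ * x ^ i * (l₂ * x ^ j)
        rw [pow_add, mul_assoc l₁ (x ^ i), ← mul_assoc (x ^ i), hil]
        simp only [mul_assoc] }
  have hM : (M : Set D).Finite :=
    Set.Finite.image2 _ (Set.toFinite (L : Set D)) (hpowers x hx)
  have haM : a ∈ M := ⟨a, haL, 1, one_mem _, mul_one a⟩
  have hxM : x ∈ M := ⟨1, one_mem L, x, Submonoid.mem_powers x, one_mul x⟩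
  have : Finite (Algebra.adjoin (ZMod p) {a, x}) :=
    Subalgebra.finite_adjoin_of_subset_submonoid _ M (by simp [Set.insert_subset_iff, haM, hxM]) hM
  have hax := Subalgebra.commute_of_finite (Algebra.adjoin (ZMod p) {a, x})
    (x := a) (y := x) (Algebra.subset_adjoin (by simp)) (Algebra.subset_adjoin (by simp))
  rw [hax, sub_self] at hcx
  exact mul_ne_zero hc hx hcx.symm

theorem mul_comm_of_forall_pow_eq_one {D : Type*} [DivisionRing D] {n : ℕ} (hn : 0 < n)
    (h : ∀ u : D, u ≠ 0 → u ^ n = 1)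
    (a b : D) : a * b = b * a := by
  obtain ⟨p, hp⟩ := CharP.exists D
  rcases CharP.char_is_prime_or_zero D p with hprime | rfl
  · have : Fact p.Prime := ⟨hprime⟩
    exact mul_comm_of_forall_pow_eq_one_of_charP p hn h a b
  · have : CharZero D := CharP.charP_to_charZero D
    have h2 : ((2 ^ n : ℕ) : D) = (1 : ℕ) := by
      push_cast
      exact h 2 two_ne_zero
    exact absurd (Nat.cast_injective h2) (Nat.one_lt_two_pow hn.ne').ne'

theorem finite_and_card_sub_one_dvd_of_forall_pow_eq_one {F : Type*} [Field F] {n : ℕ}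
    (hn : 0 < n) (h : ∀ u : F, u ≠ 0 → u ^ n = 1) : Finite F ∧ (Nat.card F - 1) ∣ n := by
  classical
  have hfin : Finite F := by
    refine Set.finite_univ_iff.mp
      ((insert 0 (Polynomial.nthRootsFinset n (1 : F))).finite_toSet.subset fun u _ => ?_)
    by_cases hu : u = 0
    · simp [hu]
    · simp [Polynomial.mem_nthRootsFinset hn, h u hu]
  refine ⟨hfin, ?_⟩
  rw [← Nat.card_units, ← IsCyclic.exponent_eq_card]
  exact Monoid.exponent_dvd_of_forall_pow_eq_one fun u => Units.ext (by simpa using h u u.ne_zero)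

theorem IsNDeltaU.pow_eq_one {D : Type*} [DivisionRing D] {n : ℕ} (h : IsNDeltaU D n) {u : D}
    (hu : u ≠ 0) : u ^ n = 1 := by
  by_contra hne
  have hsub := sub_ne_zero.mpr hne
  have := h (Units.mk0 u hu) (Units.mk0 _ hsub)⁻¹
  simp [hsub] at this

theorem divisionRing_nDeltaU_commutative_finite (D : Type*) [DivisionRing D] (n : ℕ)
    (hn : 2 ≤ n) (h : IsNDeltaU D n) :
    (∀ a b : D, a * b = b * a) ∧ Finite D ∧ (Nat.card D - 1) ∣ n := by
  have hpos : 0 < n := by omega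
  have hpow (u : D) (hu : u ≠ 0) : u ^ n = 1 := h.pow_eq_one hu
  have hcomm := mul_comm_of_forall_pow_eq_one hpos hpow
  let : Field D := { ‹DivisionRing D› with mul_comm := hcomm }
  exact ⟨hcomm, finite_and_card_sub_one_dvd_of_forall_pow_eq_one hpos hpow⟩
end

section
/- Let R be an n-ΔU ring and let f : R → T be a surjective ring homomorphism such that every unit of T lifts to a unit of R (i.e., for every unit v of T there is a unit u of R with f(u) = v). Then T is an n-ΔU ring. -/
theorem isNDeltaU_of_surjective_unit_lift (R T : Type*) [Ring R] [Ring T] (n : ℕ)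
    (hn : 1 ≤ n) (h : IsNDeltaU R n) (f : R →+* T) (hf : Function.Surjective f)
    (hlift : ∀ v : Tˣ, ∃ u : Rˣ, f (u : R) = (v : T)) :
    IsNDeltaU T n := by
  intro v w
  obtain ⟨u, hu⟩ := hlift v
  obtain ⟨x, hx⟩ := hlift w
  have key := (h u x).map f
  rwa [map_sub, map_mul, map_sub, map_pow, map_one, hu, hx] at key
end

section
/- Let R be a ring, n ≥ 1 a fixed integer, and I a two-sided ideal of R with I ⊆ J(R), where J(R) is the Jacobson radical of R. Then R is an n-ΔU ring if and only if the quotient ring R/I is an n-ΔU ring. -/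
theorem exists_left_inverse_of_mem_jacobson_bot {R : Type*} [Ring R] {x : R}
    (hx : x ∈ Ideal.jacobson (⊥ : Ideal R)) : ∃ z, z * (1 + x) = 1 := by
  obtain ⟨z, hz⟩ := Ideal.mem_jacobson_iff.1 hx 1
  rw [mul_one, Ideal.mem_bot, sub_eq_zero] at hz
  exact ⟨z, by rw [mul_add, mul_one, add_comm, hz]⟩

theorem isUnit_one_add_of_mem_jacobson_bot {R : Type*} [Ring R] {x : R}
    (hx : x ∈ Ideal.jacobson (⊥ : Ideal R)) : IsUnit (1 + x) := by
  obtain ⟨z, hz⟩ := exists_left_inverse_of_mem_jacobson_bot hx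
  obtain ⟨w, hw⟩ := exists_left_inverse_of_mem_jacobson_bot
    (neg_mem (Ideal.mul_mem_left _ z hx))
  have hz' : 1 + -(z * x) = z := by
    rw [← sub_eq_add_neg, sub_eq_iff_eq_add, ← hz, mul_add, mul_one]
  rw [hz'] at hw
  have hwx : w = 1 + x := left_inv_eq_right_inv hw hz
  exact ⟨⟨1 + x, z, hwx ▸ hw, hz⟩, rfl⟩

theorem TwoSidedIdeal.isLocalHom_mk' {R : Type*} [Ring R] {I : TwoSidedIdeal R}
    (hI : I ≤ TwoSidedIdeal.jacobson (⊥ : TwoSidedIdeal R)) : IsLocalHom I.ringCon.mk' := by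
  have key : ∀ c : R, I.ringCon.mk' c = 1 → IsUnit c := by
    intro c hc
    have hmem : c - 1 ∈ I := by
      rw [← TwoSidedIdeal.rel_iff]
      exact (RingCon.eq _).1 hc
    have hJ := TwoSidedIdeal.mem_asIdeal.2 (hI hmem)
    rw [TwoSidedIdeal.asIdeal_jacobson, TwoSidedIdeal.bot_asIdeal] at hJ
    simpa using isUnit_one_add_of_mem_jacobson_bot hJ
  refine ⟨fun a ha => ?_⟩
  obtain ⟨u, hu⟩ := ha
  obtain ⟨b, hb⟩ := I.ringCon.mk'_surjective (↑u⁻¹ : I.ringCon.Quotient)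
  obtain ⟨v, hv⟩ := key (a * b) (by rw [map_mul, hb, ← hu, Units.mul_inv])
  obtain ⟨w, hw⟩ := key (b * a) (by rw [map_mul, hb, ← hu, Units.inv_mul])
  refine isUnit_iff_exists_and_exists.2 ⟨⟨b * ↑v⁻¹, ?_⟩, ⟨↑w⁻¹ * b, ?_⟩⟩
  · rw [← mul_assoc, ← hv, Units.mul_inv]
  · rw [mul_assoc, ← hw, Units.inv_mul]

theorem isNDeltaU_iff_of_surjective {R S : Type*} [Ring R] [Ring S] (f : R →+* S)
    [IsLocalHom f] (hf : Function.Surjective f) (n : ℕ) : IsNDeltaU R n ↔ IsNDeltaU S n := by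
  constructor
  · intro h u v
    obtain ⟨a, ha⟩ := hf u
    obtain ⟨b, hb⟩ := hf v
    obtain ⟨a, rfl⟩ : IsUnit a := isUnit_of_map_unit f a (ha ▸ u.isUnit)
    obtain ⟨b, rfl⟩ : IsUnit b := isUnit_of_map_unit f b (hb ▸ v.isUnit)
    simpa [ha, hb] using (h a b).map f
  · intro h u v
    refine isUnit_of_map_unit f _ ?_
    simpa using h (Units.map f u) (Units.map f v)

theorem isNDeltaU_iff_quotient (R : Type*) [Ring R] (n : ℕ) (hn : 1 ≤ n)
    (I : TwoSidedIdeal R) (hI : I ≤ TwoSidedIdeal.jacobson (⊥ : TwoSidedIdeal R)) :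
    IsNDeltaU R n ↔ IsNDeltaU I.ringCon.Quotient n := by
  have := TwoSidedIdeal.isLocalHom_mk' hI
  exact isNDeltaU_iff_of_surjective I.ringCon.mk' I.ringCon.mk'_surjective n
end

section
/- A ring R is an n-ΔU ring if and only if the quotient R/J(R) by its Jacobson radical is an n-ΔU ring. -/
theorem isUnit_of_sub_one_mem_twoSidedIdeal_jacobson_bot {R : Type*} [Ring R] {r : R}
    (h : r - 1 ∈ TwoSidedIdeal.jacobson (⊥ : TwoSidedIdeal R)) : IsUnit r := by
  have left_inv : ∀ x : R, x - 1 ∈ TwoSidedIdeal.jacobson (⊥ : TwoSidedIdeal R) →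
      ∃ s, s * x = 1 := by
    intro x hx
    obtain ⟨z, hz⟩ := TwoSidedIdeal.mem_jacobson_iff.1 hx 1
    rw [TwoSidedIdeal.mem_bot] at hz
    refine ⟨z, ?_⟩
    rw [mul_one, mul_sub, mul_one, sub_add_cancel] at hz
    exact sub_eq_zero.1 hz
  obtain ⟨s, hs⟩ := left_inv r h
  have hs' : s - 1 ∈ TwoSidedIdeal.jacobson (⊥ : TwoSidedIdeal R) := by
    have : s - 1 = -(s * (r - 1)) := by rw [mul_sub, hs, mul_one, neg_sub]
    rw [this]
    exact neg_mem (TwoSidedIdeal.mul_mem_left _ _ _ h)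
  obtain ⟨t, ht⟩ := left_inv s hs'
  have htr : t = r := left_inv_eq_right_inv ht hs
  exact ⟨⟨r, s, htr ▸ ht, hs⟩, rfl⟩

theorem isLocalHom_mk'_jacobson_bot (R : Type*) [Ring R] :
    IsLocalHom (TwoSidedIdeal.jacobson (⊥ : TwoSidedIdeal R)).ringCon.mk' where
  map_nonunit a ha := by
    obtain ⟨c, hca, hac⟩ := isUnit_iff_exists.1 ha
    obtain ⟨b, rfl⟩ := RingCon.mk'_surjective _ c
    have isUnit_of_map_eq_one : ∀ x : R,
        (TwoSidedIdeal.jacobson (⊥ : TwoSidedIdeal R)).ringCon.mk' x = 1 → IsUnit x := by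
      intro x hx
      apply isUnit_of_sub_one_mem_twoSidedIdeal_jacobson_bot
      rw [← TwoSidedIdeal.rel_iff]
      exact (RingCon.eq _).1 hx
    rw [← map_mul] at hca hac
    obtain ⟨u, hu⟩ := isUnit_of_map_eq_one _ hca
    obtain ⟨v, hv⟩ := isUnit_of_map_eq_one _ hac
    refine isUnit_iff_exists_and_exists.2 ⟨⟨b * ↑u⁻¹, ?_⟩, ⟨↑v⁻¹ * b, ?_⟩⟩
    · rw [← mul_assoc, ← hu, Units.mul_inv]
    · rw [mul_assoc, ← hv, Units.inv_mul]

theorem mem_Delta_iff_map_mem_Delta {R S : Type*} [Ring R] [Ring S] (f : R →+* S) [IsLocalHom f]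
    (hf : Function.Surjective f) (a : R) : a ∈ Delta R ↔ f a ∈ Delta S := by
  constructor
  · intro h v
    obtain ⟨u, hu⟩ := hf v
    obtain ⟨u, rfl⟩ := isUnit_of_map_unit f u (hu ▸ v.isUnit)
    simpa [hu] using (h u).map f
  · intro h u
    apply isUnit_of_map_unit f
    simpa using h (Units.map (f : R →* S) u)

theorem isNDeltaU_iff_quotient_jacobson (R : Type*) [Ring R] (n : ℕ) (hn : 1 ≤ n) :
    IsNDeltaU R n ↔
      IsNDeltaU (TwoSidedIdeal.jacobson (⊥ : TwoSidedIdeal R)).ringCon.Quotient n := by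
  have := isLocalHom_mk'_jacobson_bot R
  exact isNDeltaU_iff_of_surjective _ (RingCon.mk'_surjective _) n
end

section
/- Let R be an n-ΔU ring and let e be an idempotent of R. Then the corner ring eRe = {exe : x ∈ R}, with the operations inherited from R and identity element e, is an n-ΔU ring. -/
/-- The corner ring `eRe = {exe : x ∈ R} = {x : R | e * x * e = x}` of a ring `R`
at an element `e`. -/
def Corner (R : Type*) [Ring R] (e : R) : Type _ :=
  {x : R // e * x * e = x}

/-- For an idempotent `e`, the corner `eRe` is a ring whose identity element is `e`,
with operations inherited from `R`. -/
def cornerRing (R : Type*) [Ring R] (e : R) (he : IsIdempotentElem e) :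
    Ring (Corner R e) where
  add x y := ⟨x.1 + y.1, by rw [mul_add, add_mul, x.2, y.2]⟩
  zero := ⟨0, by simp⟩
  neg x := ⟨-x.1, by simpa using x.2⟩
  mul x y := ⟨x.1 * y.1, by
    have hx : e * x.1 = x.1 := by
      conv_lhs => rw [← x.2]
      rw [← mul_assoc, ← mul_assoc, he.eq]
      exact x.2
    have hy : y.1 * e = y.1 := by
      conv_lhs => rw [← y.2]
      rw [mul_assoc, mul_assoc, he.eq, ← mul_assoc]
      exact y.2
    rw [← mul_assoc, mul_assoc e x.1 y.1, ← mul_assoc e x.1 y.1, hx, mul_assoc, hy]⟩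
  one := ⟨e, by rw [he.eq, he.eq]⟩
  add_assoc x y z := Subtype.ext (add_assoc x.1 y.1 z.1)
  zero_add x := Subtype.ext (zero_add x.1)
  add_zero x := Subtype.ext (add_zero x.1)
  add_comm x y := Subtype.ext (add_comm x.1 y.1)
  neg_add_cancel x := Subtype.ext (neg_add_cancel x.1)
  mul_assoc x y z := Subtype.ext (mul_assoc x.1 y.1 z.1)
  one_mul x := Subtype.ext (by
    show e * x.1 = x.1
    conv_lhs => rw [← x.2]
    rw [← mul_assoc, ← mul_assoc, he.eq]
    exact x.2)
  mul_one x := Subtype.ext (by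
    show x.1 * e = x.1
    conv_lhs => rw [← x.2]
    rw [mul_assoc, mul_assoc, he.eq, ← mul_assoc]
    exact x.2)
  left_distrib x y z := Subtype.ext (left_distrib x.1 y.1 z.1)
  right_distrib x y z := Subtype.ext (right_distrib x.1 y.1 z.1)
  zero_mul x := Subtype.ext (zero_mul x.1)
  mul_zero x := Subtype.ext (mul_zero x.1)
  nsmul n x := ⟨n • x.1, by rw [mul_smul_comm, smul_mul_assoc, x.2]⟩
  nsmul_zero x := Subtype.ext (zero_smul ℕ x.1)
  nsmul_succ n x := Subtype.ext (succ_nsmul x.1 n)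
  zsmul n x := ⟨n • x.1, by rw [mul_smul_comm, smul_mul_assoc, x.2]⟩
  zsmul_zero' x := Subtype.ext (zero_smul ℤ x.1)
  zsmul_succ' n x := Subtype.ext (by
    show ((n : ℤ) + 1) • x.1 = (n : ℤ) • x.1 + x.1
    rw [add_smul, one_smul])
  zsmul_neg' n x := Subtype.ext (by
    show (Int.negSucc n) • x.1 = -(((n : ℕ) + 1 : ℤ) • x.1)
    rw [negSucc_zsmul]
    norm_num)

namespace Corner

variable {R : Type*} [Ring R] {e : R}

theorem idem_mul_val (he : IsIdempotentElem e) (x : Corner R e) : e * x.1 = x.1 := by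
  let := cornerRing R e he
  exact congrArg Subtype.val (one_mul x)

theorem val_mul_idem (he : IsIdempotentElem e) (x : Corner R e) : x.1 * e = x.1 := by
  let := cornerRing R e he
  exact congrArg Subtype.val (mul_one x)

theorem val_sub (he : IsIdempotentElem e) (x y : Corner R e) :
    letI := cornerRing R e he
    (x - y).1 = x.1 - y.1 :=
  (sub_eq_add_neg x.1 y.1).symm

theorem add_one_sub_mul (he : IsIdempotentElem e) (x y : Corner R e) :
    (x.1 + (1 - e)) * (y.1 + (1 - e)) = x.1 * y.1 + (1 - e) := by
  simp only [mul_add, add_mul, mul_sub, sub_mul, mul_one, one_mul, idem_mul_val he,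
    val_mul_idem he, he.eq]
  abel

/-- Extension of a unit of the corner ring `eRe` to a unit of `R` by adding `1 - e`. -/
def unitExtend (he : IsIdempotentElem e) (u : @Units (Corner R e) (cornerRing R e he).toMonoid) :
    Rˣ :=
  letI := cornerRing R e he
  { val := u.val.1 + (1 - e)
    inv := u.inv.1 + (1 - e)
    val_inv := by
      have h : u.val.1 * u.inv.1 = e := congrArg Subtype.val u.val_inv
      rw [add_one_sub_mul he, h, add_sub_cancel]
    inv_val := by
      have h : u.inv.1 * u.val.1 = e := congrArg Subtype.val u.inv_val
      rw [add_one_sub_mul he, h, add_sub_cancel] }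

theorem add_one_sub_pow (he : IsIdempotentElem e) (x : Corner R e) (n : ℕ) :
    letI := cornerRing R e he
    (x.1 + (1 - e)) ^ n = (x ^ n).1 + (1 - e) := by
  let := cornerRing R e he
  induction n with
  | zero =>
    have h : (x ^ 0).1 = e := congrArg Subtype.val (pow_zero x)
    rw [pow_zero, h, add_sub_cancel]
  | succ k ih =>
    have h : (x ^ (k + 1)).1 = (x ^ k).1 * x.1 := congrArg Subtype.val (pow_succ x k)
    rw [pow_succ, ih, add_one_sub_mul he, h]

theorem isUnit_of_isUnit_add_one_sub (he : IsIdempotentElem e) (x : Corner R e)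
    (hx : IsUnit (x.1 + (1 - e))) :
    @IsUnit (Corner R e) (cornerRing R e he).toMonoid x := by
  let := cornerRing R e he
  obtain ⟨w, hw⟩ := hx
  have hcomm : Commute e (w : R) := by
    rw [hw, commute_iff_eq]
    simp only [mul_add, add_mul, mul_sub, sub_mul, mul_one, one_mul, idem_mul_val he,
      val_mul_idem he]
  have hinv : Commute e (↑w⁻¹ : R) := hcomm.units_inv_right
  have hxw : x.1 = w * e := by
    rw [hw, add_mul, sub_mul, one_mul, he.eq, sub_self, add_zero, val_mul_idem he]
  let y : Corner R e := ⟨e * ↑w⁻¹, by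
    rw [← mul_assoc, he.eq, mul_assoc, ← hinv.eq, ← mul_assoc, he.eq]⟩
  refine ⟨⟨x, y, Subtype.ext ?_, Subtype.ext ?_⟩, rfl⟩
  · change x.1 * (e * ↑w⁻¹) = e
    rw [← mul_assoc, val_mul_idem he, hxw, ← hcomm.eq, mul_assoc, w.mul_inv, mul_one]
  · change e * ↑w⁻¹ * x.1 = e
    rw [hxw, mul_assoc, ← mul_assoc (↑w⁻¹ : R), w.inv_mul, one_mul, he.eq]

end Corner

/-- If `R` is an `n`-ΔU ring and `e` is an idempotent of `R`, then the corner ring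
`eRe` is an `n`-ΔU ring. -/
theorem corner_isNDeltaU (R : Type*) [Ring R] (n : ℕ) (hn : 1 ≤ n)
    (h : IsNDeltaU R n) (e : R) (he : IsIdempotentElem e) :
    @IsNDeltaU (Corner R e) (cornerRing R e he) n := by
  let := cornerRing R e he
  intro u v
  apply Corner.isUnit_of_isUnit_add_one_sub he
  have key := h (Corner.unitExtend he u) (Corner.unitExtend he v)
  convert key using 1
  change _ = 1 - (v.val.1 + (1 - e)) * ((u.val.1 + (1 - e)) ^ n - 1)
  rw [Corner.add_one_sub_pow he, Corner.val_sub he]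
  change e - v.val.1 * (u.val ^ n - 1 : Corner R e).1 + (1 - e) = _
  rw [Corner.val_sub he]
  change e - v.val.1 * ((u.val ^ n : Corner R e).1 - e) + (1 - e) = _
  simp only [mul_add, add_mul, mul_sub, sub_mul, mul_one, one_mul, Corner.idem_mul_val he,
    Corner.val_mul_idem he, he.eq]
  abel
end

section
/- Let R be a nonzero ring and let n ≥ 2. Then for every integer k ≥ 1, the ring Mₙ(R) of n × n matrices over R is not a (2k−1)-ΔU ring. -/
/-- If `R` is `n`-ΔU with `n` odd and `u` is an involution, then no unit multiple of `u - 1` is a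
nonzero idempotent. -/
theorem IsNDeltaU.idempotent_eq_zero {R : Type*} [Ring R] {n : ℕ} (h : IsNDeltaU R n)
    (hn : Odd n) {u v : R} (hu : u * u = 1) (hv : v * v = 1)
    (he : IsIdempotentElem (v * (u - 1))) : v * (u - 1) = 0 := by
  have hpow : u ^ n = u := by
    obtain ⟨j, rfl⟩ := hn
    rw [pow_succ, pow_mul, pow_two, hu, one_pow, one_mul]
  have hunit : IsUnit (1 - v * (u ^ n - 1)) := h ⟨u, u, hu, hu⟩ ⟨v, v, hv, hv⟩
  rw [hpow] at hunit
  refine hunit.mul_left_cancel ?_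
  rw [sub_mul, he.eq, one_mul, sub_self, mul_zero]

theorem matrix_not_isNDeltaU (R : Type*) [Ring R] [Nontrivial R] (n : ℕ) (hn : 2 ≤ n)
    (k : ℕ) (hk : 1 ≤ k) :
    ¬ IsNDeltaU (Matrix (Fin n) (Fin n) R) (2 * k - 1) := by
  intro h
  let i : Fin n := ⟨0, by omega⟩
  let j : Fin n := ⟨1, by omega⟩
  have hij : i ≠ j := by simp [i, j]
  have hji : j ≠ i := hij.symm
  let E : Fin n → Fin n → Matrix (Fin n) (Fin n) R := fun s t => Matrix.single s t 1
  have hE : ∀ s t r, E s t * E t r = E s r := fun s t r => by simp [E]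
  have hE' : ∀ s t t' r, t ≠ t' → E s t * E t' r = 0 := fun s t t' r ht => by
    simp [E, ht]
  have hu : (1 - E i i + E i j + E j i - E j j) * (1 - E i i + E i j + E j i - E j j) = 1 := by
    simp only [mul_add, add_mul, mul_sub, sub_mul, one_mul, mul_one, hE, hE' _ _ _ _ hij,
      hE' _ _ _ _ hji]
    abel
  have hv : (1 - E i i - E i i + E j i) * (1 - E i i - E i i + E j i) = 1 := by
    simp only [mul_add, add_mul, mul_sub, sub_mul, one_mul, mul_one, hE, hE' _ _ _ _ hij]
    abel
  have hf : (1 - E i i - E i i + E j i) * ((1 - E i i + E i j + E j i - E j j) - 1) =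
      E i i - E i j := by
    simp only [mul_add, add_mul, mul_sub, sub_mul, one_mul, mul_one, hE, hE' _ _ _ _ hij]
    abel
  have he : IsIdempotentElem (E i i - E i j) := by
    simp only [IsIdempotentElem, mul_sub, sub_mul, hE, hE' _ _ _ _ hji]
    abel
  have hzero := h.idempotent_eq_zero ⟨k - 1, by omega⟩ hu hv (hf ▸ he)
  rw [hf] at hzero
  simpa [E, hji] using congrFun (congrFun hzero i) i
end

section
/- Every (2k−1)-ΔU ring (for a fixed integer k ≥ 1) is Dedekind-finite: for all a, b ∈ R, if ab = 1 then ba = 1. -/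
namespace Delta

variable {R : Type*} [Ring R]

theorem units_mul_mem {a : R} (ha : a ∈ Delta R) (v : Rˣ) : (v : R) * a ∈ Delta R := by
  intro u
  have h := ha (u * v)
  rwa [Units.val_mul, mul_assoc] at h

theorem neg_mem {a : R} (ha : a ∈ Delta R) : -a ∈ Delta R := by
  simpa using units_mul_mem ha (-1)

theorem zero_mem : (0 : R) ∈ Delta R := fun u => by simp

theorem add_mem {a b : R} (ha : a ∈ Delta R) (hb : b ∈ Delta R) : a + b ∈ Delta R := by
  intro u
  obtain ⟨w, hw⟩ := ha u
  have h := w.isUnit.mul (hb (w⁻¹ * u))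
  have e : (w : R) * (1 - ((w⁻¹ * u : Rˣ) : R) * b) = 1 - (u : R) * (a + b) := by
    rw [Units.val_mul, mul_sub, mul_one, mul_assoc, Units.mul_inv_cancel_left, hw, mul_add,
      sub_sub]
  rwa [e] at h

theorem nsmul_mem {a : R} (ha : a ∈ Delta R) (m : ℕ) : m • a ∈ Delta R := by
  induction m with
  | zero => simpa using zero_mem
  | succ m ih => rw [succ_nsmul]; exact add_mem ih ha

/-- If `x` and `y` are square-zero, `xyx = x`, `yxy = y`, and `x + y ∈ Δ(R)`, then `x = 0`. -/
theorem eq_zero_of_add_mem {x y : R} (hx : x * x = 0) (hy : y * y = 0) (hxy : x * y * x = x)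
    (hyx : y * x * y = y) (h : x + y ∈ Delta R) : x = 0 := by
  have hxy' : x * (y * x) = x := by rw [← mul_assoc, hxy]
  have hyx' : y * (x * y) = y := by rw [← mul_assoc, hyx]
  have hx' (z : R) : x * (x * z) = 0 := by rw [← mul_assoc, hx, zero_mul]
  have hy' (z : R) : y * (y * z) = 0 := by rw [← mul_assoc, hy, zero_mul]
  have hv : (x + y + 1 - x * y - y * x) * (x + y + 1 - x * y - y * x) = 1 := by
    simp only [mul_add, add_mul, mul_sub, sub_mul, mul_assoc, hx, hy, hxy', hyx', hx', hy',
      mul_one, one_mul, mul_zero]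
    abel
  have hs : (x + y + 1 - x * y - y * x) * (x + y) = x * y + y * x := by
    simp only [mul_add, add_mul, sub_mul, mul_assoc, hx, hy, hxy', hyx',
      one_mul, mul_zero]
    abel
  have hu : IsUnit (1 - (x * y + y * x)) := by
    have := h ⟨_, _, hv, hv⟩
    rwa [hs] at this
  refine hu.mul_left_eq_zero.mp ?_
  simp only [mul_add, mul_sub, mul_one, hx', hxy']
  abel

end Delta

namespace IsNDeltaU

variable {R : Type*} [Ring R] {n : ℕ}

theorem two_mem (h : IsNDeltaU R n) (hn : Odd n) : (2 : R) ∈ Delta R := by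
  have h1 := Delta.neg_mem (h (-1))
  rw [Units.val_neg, Units.val_one, hn.neg_one_pow] at h1
  convert h1 using 1
  norm_num

theorem mem_of_mul_self_eq_zero (h : IsNDeltaU R n) (hn : Odd n) {x : R} (hx : x * x = 0) :
    x ∈ Delta R := by
  have hpow (m : ℕ) : (1 + x) ^ m = 1 + m • x := by
    induction m with
    | zero => simp
    | succ m ih =>
      rw [pow_succ, ih, add_mul, one_mul, smul_mul_assoc, mul_add, mul_one, hx, add_zero,
        succ_nsmul]
      abel
  let u : Rˣ := ⟨1 + x, 1 - x, by simp [mul_sub, add_mul, hx], by simp [mul_add, sub_mul, hx]⟩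
  have hnx : n • x ∈ Delta R := by
    have := h u
    rwa [show (u : R) = 1 + x from rfl, hpow, add_sub_cancel_left] at this
  have h2x : 2 • x ∈ Delta R := by
    have := Delta.add_mem (Delta.units_mul_mem (h.two_mem hn) u) (Delta.neg_mem (h.two_mem hn))
    convert this using 1
    rw [show (u : R) = 1 + x from rfl, add_mul, one_mul, mul_two, two_nsmul]
    abel
  obtain ⟨m, rfl⟩ := hn
  have := Delta.add_mem hnx (Delta.neg_mem (Delta.nsmul_mem h2x m))
  convert this using 1
  rw [add_nsmul, one_nsmul, mul_comm, mul_nsmul']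
  abel

end IsNDeltaU

theorem dedekindFinite_of_isNDeltaU (R : Type*) [Ring R] (k : ℕ) (hk : 1 ≤ k)
    (h : IsNDeltaU R (2 * k - 1)) :
    ∀ a b : R, a * b = 1 → b * a = 1 := by
  intro a b hab
  have hn : Odd (2 * k - 1) := ⟨k - 1, by omega⟩
  obtain ⟨e, he⟩ : ∃ e, e = 1 - b * a := ⟨_, rfl⟩
  have hae : a * e = 0 := by rw [he, mul_sub, ← mul_assoc, hab]; simp
  have heb : e * b = 0 := by rw [he, sub_mul, mul_assoc, hab]; simp
  have hee : e * e = e := by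
    nth_rw 1 [he]
    rw [sub_mul, one_mul, mul_assoc, hae, mul_zero, sub_zero]
  have hx : e * a * (e * a) = 0 := by
    rw [mul_assoc, ← mul_assoc a, hae, zero_mul, mul_zero]
  have hy : b * e * (b * e) = 0 := by
    rw [mul_assoc, ← mul_assoc e, heb, zero_mul, mul_zero]
  have hxy : e * a * (b * e) = e := by
    rw [mul_assoc, ← mul_assoc a, hab, one_mul, hee]
  have hea : e * a = 0 := by
    refine Delta.eq_zero_of_add_mem hx hy ?_ ?_
      (Delta.add_mem (h.mem_of_mul_self_eq_zero hn hx) (h.mem_of_mul_self_eq_zero hn hy))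
    · rw [hxy, ← mul_assoc, hee]
    · rw [mul_assoc, hxy, mul_assoc, hee]
  have he0 : e = 0 := by rw [← hxy, hea, zero_mul]
  rw [he0] at he
  exact (sub_eq_zero.mp he.symm).symm
end

section
/- Let R be a (2n−1)-ΔU ring for some n ≥ 1. If J(R) = {0} and every nonzero right ideal of R contains a nonzero idempotent, then R is reduced (R has no nonzero nilpotent elements). -/
/-- If `a` squares to zero and `a * r` is idempotent, then `a * r * a` has a quasi-inverse
squaring to zero. -/
theorem exists_quasi_inverse {R : Type*} [Ring R] {a r : R} (ha : a * a = 0)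
    (he : IsIdempotentElem (a * r)) :
    ∃ y : R, y * y = 0 ∧ (a * r * a) * y * (a * r * a) = a * r * a ∧
      y * (a * r * a) * y = y := by
  have ha' (z : R) : a * (a * z) = 0 := by rw [← mul_assoc, ha, zero_mul]
  have hr : a * (r * (a * r)) = a * r := by simpa [mul_assoc] using he.eq
  have hr' (z : R) : a * (r * (a * (r * z))) = a * (r * z) := by
    simpa [mul_assoc] using congrArg (· * z) hr
  refine ⟨r * a * r - r * a * r * (r * a * r * a), ?_, ?_, ?_⟩ <;>
    simp [mul_sub, sub_mul, mul_assoc, ha', hr, hr']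

/-- In an `m`-ΔU ring with `m` odd there are no nonzero `2 × 2` matrix units: a pair of mutually
quasi-inverse square-zero elements is trivial. -/
theorem eq_zero_of_isNDeltaU {R : Type*} [Ring R] {m : ℕ} (hm : Odd m) (h : IsNDeltaU R m)
    {x y : R} (hx : x * x = 0) (hy : y * y = 0) (hxyx : x * y * x = x) (hyxy : y * x * y = y) :
    x = 0 := by
  have hx' (z : R) : x * (x * z) = 0 := by rw [← mul_assoc, hx, zero_mul]
  have hy' (z : R) : y * (y * z) = 0 := by rw [← mul_assoc, hy, zero_mul]
  have h₁ : x * (y * x) = x := by rw [← mul_assoc, hxyx]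
  have h₂ : y * (x * y) = y := by rw [← mul_assoc, hyxy]
  have huu : (1 - x * y - y * x + x + y) * (1 - x * y - y * x + x + y) = 1 := by
    simp only [mul_add, add_mul, mul_sub, sub_mul, mul_assoc, hx, hx', hy, hy', h₁, h₂,
      mul_one, one_mul, mul_zero]
    abel
  let u : Rˣ := ⟨_, _, huu, huu⟩
  let v : Rˣ := ⟨1 - x * y + x + y, 1 - x * y - y * x - x * y + x + y,
    by
      simp only [mul_add, add_mul, mul_sub, sub_mul, mul_assoc, hx, hx', hy, hy', h₁, h₂,
        mul_one, one_mul, mul_zero]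
      abel,
    by
      simp only [mul_add, add_mul, mul_sub, sub_mul, mul_assoc, hx, hx', hy, h₁, h₂,
        mul_one, one_mul, mul_zero]
      abel⟩
  have hum : (u : R) ^ m = u := by
    obtain ⟨k, rfl⟩ := hm
    rw [pow_succ, pow_mul, pow_two, show (u : R) * u = 1 from huu, one_pow, one_mul]
  have hunit : IsUnit (1 - (v : R) * (u - 1)) := hum ▸ h u v
  have hvu : (v : R) * (u - 1) = x * y - x := by
    change (1 - x * y + x + y) * (1 - x * y - y * x + x + y - 1) = _
    simp only [mul_add, add_mul, mul_sub, sub_mul, mul_assoc, hx, hx', hy, hy', h₁, h₂,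
      mul_one, one_mul, mul_zero]
    abel
  rw [hvu] at hunit
  have hp : x * y - x = 0 := by
    refine hunit.mul_left_eq_zero.mp ?_
    simp [mul_sub, sub_mul, mul_assoc, hx, hx', h₁, h₂]
  calc x = (x * y - x) * x := by rw [sub_mul, hxyx, hx, sub_zero]
    _ = 0 := by rw [hp, zero_mul]

/-- If `R` is a `(2n-1)`-ΔU ring with zero Jacobson radical in which every nonzero
right ideal contains a nonzero idempotent, then `R` is reduced. -/
theorem reduced_of_isNDeltaU (R : Type*) [Ring R] (n : ℕ) (hn : 1 ≤ n)
    (h : IsNDeltaU R (2 * n - 1))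
    (hJ : TwoSidedIdeal.jacobson (⊥ : TwoSidedIdeal R) = ⊥)
    (hid : ∀ I : Submodule Rᵐᵒᵖ R, I ≠ ⊥ →
      ∃ e ∈ I, e ≠ 0 ∧ IsIdempotentElem e) :
    IsReduced R := by
  rw [isReduced_iff_pow_one_lt 2 one_lt_two]
  intro a ha
  by_contra ha0
  obtain ⟨e, he, he0, hee⟩ := hid (Submodule.span Rᵐᵒᵖ {a})
    (by simpa [Submodule.span_singleton_eq_bot] using ha0)
  obtain ⟨c, rfl⟩ := Submodule.mem_span_singleton.mp he
  obtain ⟨r, rfl⟩ := MulOpposite.op_surjective c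
  rw [op_smul_eq_mul] at he0 hee
  obtain ⟨y, hyy, hxyx, hyxy⟩ := exists_quasi_inverse (by rwa [pow_two] at ha) hee
  have hxx : (a * r * a) * (a * r * a) = 0 := by
    have haa : a * a = 0 := by rwa [pow_two] at ha
    rw [show (a * r * a) * (a * r * a) = a * r * (a * a) * (r * a) by noncomm_ring, haa]
    simp
  have hx : a * r * a = 0 :=
    eq_zero_of_isNDeltaU ⟨n - 1, by omega⟩ h hxx hyy hxyx hyxy
  apply he0
  rw [← hee.eq, ← mul_assoc, hx, zero_mul]
end

section
/- Let R be a ring and n ≥ 1. The following are equivalent: (i) R is von Neumann regular and (2n−1)-ΔU; (ii) R is π-regular, reduced, and (2n−1)-ΔU; (iii) R satisfies the identity x^{2n} = x for all x ∈ R. -/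
/-- A ring is (von Neumann) regular if every `a` satisfies `a = a * x * a` for some `x`. -/
def IsVNRegularRing (R : Type*) [Ring R] : Prop :=
  ∀ a : R, ∃ x : R, a * x * a = a

/-- A ring is π-regular if for every `a` there is `m ≥ 1` with `a ^ m ∈ a ^ m * R * a ^ m`. -/
def IsPiRegularRing (R : Type*) [Ring R] : Prop :=
  ∀ a : R, ∃ m : ℕ, 1 ≤ m ∧ ∃ x : R, a ^ m * x * a ^ m = a ^ m

section Ring

variable {R : Type*} [Ring R]

theorem isUnit_one_sub_of_mem_Delta {a : R} (ha : a ∈ Delta R) : IsUnit (1 - a) := by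
  simpa using ha 1

theorem units_mul_mem_Delta {a : R} (ha : a ∈ Delta R) (v : Rˣ) : (v : R) * a ∈ Delta R := by
  intro u
  simpa [mul_assoc] using ha (u * v)

theorem mul_units_mem_Delta {a : R} (ha : a ∈ Delta R) (v : Rˣ) : a * (v : R) ∈ Delta R := by
  intro u
  have h : (1 : R) - u * (a * v) = (↑v⁻¹ : R) * (1 - ((v * u : Rˣ) : R) * a) * v := by
    simp [mul_sub, sub_mul, mul_assoc]
  rw [h]
  exact (v⁻¹.isUnit.mul (ha _)).mul v.isUnit

theorem add_mem_Delta {a b : R} (ha : a ∈ Delta R) (hb : b ∈ Delta R) : a + b ∈ Delta R := by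
  intro u
  obtain ⟨v, hv⟩ := ha u
  have h : (1 : R) - u * (a + b) = v * (1 - ((v⁻¹ * u : Rˣ) : R) * b) := by
    rw [mul_sub, mul_one, Units.val_mul, mul_assoc, Units.mul_inv_cancel_left, hv, mul_add, sub_sub]
  rw [h]
  exact v.isUnit.mul (hb _)

variable (R) in
/-- `Δ(R)` as an additive subgroup of `R`. -/
def deltaAddSubgroup : AddSubgroup R where
  carrier := Delta R
  zero_mem' := by intro u; simp
  add_mem' := add_mem_Delta
  neg_mem' := by
    intro a ha
    simpa using units_mul_mem_Delta ha (-1)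

theorem sub_mem_Delta {a b : R} (ha : a ∈ Delta R) (hb : b ∈ Delta R) : a - b ∈ Delta R :=
  (deltaAddSubgroup R).sub_mem ha hb

theorem nsmul_mem_Delta {a : R} (ha : a ∈ Delta R) (m : ℕ) : m • a ∈ Delta R :=
  (deltaAddSubgroup R).nsmul_mem ha m

theorem isUnit_one_add_of_mul_self_eq_zero {a : R} (ha : a * a = 0) : IsUnit (1 + a) :=
  ⟨⟨1 + a, 1 - a, by simp [mul_sub, add_mul, ha], by simp [mul_add, sub_mul, ha]⟩, rfl⟩

theorem one_add_pow_of_mul_self_eq_zero {a : R} (ha : a * a = 0) (m : ℕ) :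
    (1 + a) ^ m = 1 + m • a := by
  induction m with
  | zero => simp
  | succ m ih =>
    rw [pow_succ, ih]
    simp only [mul_add, add_mul, mul_one, one_mul, smul_mul_assoc, ha, smul_zero, add_zero,
      succ_nsmul]
    abel

theorem eq_zero_of_isIdempotentElem_of_mem_Delta {e : R} (he : IsIdempotentElem e)
    (h : e ∈ Delta R) : e = 0 :=
  (isUnit_one_sub_of_mem_Delta h).mul_left_eq_zero.1 (by rw [mul_sub, mul_one, he.eq, sub_self])

theorem mul_mem_Delta_of_mul_self_eq_zero {a c : R} (ha : a ∈ Delta R) (hc : c * c = 0) :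
    a * c ∈ Delta R := by
  obtain ⟨v, hv⟩ := isUnit_one_add_of_mul_self_eq_zero hc
  have h := sub_mem_Delta (mul_units_mem_Delta ha v) ha
  rwa [hv, mul_add, mul_one, add_sub_cancel_left] at h

theorem IsNDeltaU.mem_Delta_of_mul_self_eq_zero {j : ℕ} (h : IsNDeltaU R (2 * j + 1)) {a : R}
    (ha : a * a = 0) : a ∈ Delta R := by
  obtain ⟨v, hv⟩ := isUnit_one_add_of_mul_self_eq_zero ha
  have h2 : (-2 : R) ∈ Delta R := by
    have h1 := h (-1)
    rw [Units.val_neg, Units.val_one, (odd_two_mul_add_one j).neg_one_pow] at h1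
    rwa [show (-1 - 1 : R) = -2 by norm_num] at h1
  have h2a : -2 * a ∈ Delta R := mul_mem_Delta_of_mul_self_eq_zero h2 ha
  have hk := h v
  rw [hv, one_add_pow_of_mul_self_eq_zero ha, add_sub_cancel_left] at hk
  have hs := add_mem_Delta hk (nsmul_mem_Delta h2a j)
  have e : (2 * j + 1) • a + j • (-2 * a) = a := by
    rw [neg_mul, two_mul, two_mul, add_nsmul, add_nsmul, one_nsmul, smul_neg, smul_add]
    abel
  rwa [e] at hs

theorem IsVNRegularRing.isReduced {j : ℕ} (hR : IsVNRegularRing R)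
    (h : IsNDeltaU R (2 * j + 1)) : IsReduced R := by
  rw [isReduced_iff_pow_one_lt 2 one_lt_two]
  intro a ha
  rw [pow_two] at ha
  obtain ⟨x, hx⟩ := hR a
  have hp : IsIdempotentElem (a * x) := by
    rw [IsIdempotentElem, ← mul_assoc, hx]
  have hc : ((1 - a * x) * x * (a * x)) * ((1 - a * x) * x * (a * x)) = 0 := by
    have : a * x * (1 - a * x) = 0 := by rw [mul_sub, mul_one, hp.eq, sub_self]
    calc _ = (1 - a * x) * x * (a * x * (1 - a * x)) * x * (a * x) := by simp only [mul_assoc]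
      _ = 0 := by rw [this]; simp
  have hac : a * ((1 - a * x) * x * (a * x)) = a * x := by
    have : a * (1 - a * x) = a := by rw [mul_sub, mul_one, ← mul_assoc, ha, zero_mul, sub_zero]
    rw [← mul_assoc, ← mul_assoc a, this, hp.eq]
  have hm := mul_mem_Delta_of_mul_self_eq_zero (h.mem_Delta_of_mul_self_eq_zero ha) hc
  rw [hac] at hm
  rw [← hx, eq_zero_of_isIdempotentElem_of_mem_Delta hp hm, zero_mul]

theorem IsIdempotentElem.commute_of_isReduced [IsReduced R] {e : R} (he : IsIdempotentElem e)
    (x : R) : Commute e x := by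
  have h0 : (1 - e) * e = 0 := by rw [sub_mul, one_mul, he.eq, sub_self]
  have h0' : e * (1 - e) = 0 := by rw [mul_sub, mul_one, he.eq, sub_self]
  have h1 : e * x * (1 - e) = 0 := by
    refine eq_zero_of_pow_eq_zero (n := 2) ?_
    calc _ = e * x * ((1 - e) * e) * x * (1 - e) := by simp only [pow_two, mul_assoc]
      _ = 0 := by rw [h0]; simp
  have h2 : (1 - e) * x * e = 0 := by
    refine eq_zero_of_pow_eq_zero (n := 2) ?_
    calc _ = (1 - e) * x * (e * (1 - e)) * x * e := by simp only [pow_two, mul_assoc]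
      _ = 0 := by rw [h0']; simp
  rw [mul_sub, mul_one, sub_eq_zero] at h1
  rw [sub_mul, sub_mul, one_mul, sub_eq_zero] at h2
  exact h1.trans h2.symm

theorem IsPiRegularRing.isVNRegularRing [IsReduced R] (h : IsPiRegularRing R) :
    IsVNRegularRing R := by
  intro a
  obtain ⟨m, hm, x, hx⟩ := h a
  have hq : IsIdempotentElem (x * a ^ m) := by
    rw [IsIdempotentElem, mul_assoc, ← mul_assoc (a ^ m), hx]
  have h0 : a * (1 - x * a ^ m) = 0 := by
    refine eq_zero_of_pow_eq_zero (n := m) ?_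
    rw [(hq.one_sub.commute_of_isReduced a).symm.mul_pow, hq.one_sub.pow_eq (by omega), mul_sub,
      mul_one, ← mul_assoc, hx, sub_self]
  refine ⟨x * a ^ (m - 1), ?_⟩
  rw [mul_sub, mul_one, sub_eq_zero] at h0
  rw [mul_assoc, mul_assoc, pow_sub_one_mul (by omega)]
  exact h0.symm

theorem IsVNRegularRing.exists_isIdempotentElem_mul_units [IsReduced R] (h : IsVNRegularRing R)
    (a : R) : ∃ (e : R) (v : Rˣ), IsIdempotentElem e ∧ a = e * v := by
  obtain ⟨x, hx⟩ := h a
  have hp : IsIdempotentElem (a * x) := by rw [IsIdempotentElem, ← mul_assoc, hx]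
  have hq : IsIdempotentElem (x * a) := by rw [IsIdempotentElem, mul_assoc, ← mul_assoc a, hx]
  have hpq : a * x = x * a := by
    calc a * x = a * (x * a) * x := by rw [← mul_assoc, hx]
      _ = x * a * (a * x) := by rw [(hq.commute_of_isReduced a).symm.eq, mul_assoc]
      _ = x * (a * x * a) := by
        rw [(hq.commute_of_isReduced (a * x)).eq, ← mul_assoc, (hp.commute_of_isReduced x).eq,
          mul_assoc]
      _ = x * a := by rw [hx]
  obtain ⟨e, he⟩ : ∃ e, e = a * x := ⟨_, rfl⟩
  rw [← he] at hp hx hpq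
  have hee := hp.eq
  have hae : a * e = a := by rw [← (hp.commute_of_isReduced a).eq, hx]
  have hex := (hp.commute_of_isReduced x).eq
  refine ⟨e, ⟨a + (1 - e), x * e + (1 - e), ?_, ?_⟩, hp, ?_⟩
  · have : a * (x * e) = e := by rw [← mul_assoc, ← he, hee]
    have h' : e * (x * e) = x * e := by rw [← mul_assoc, hex, mul_assoc, hee]
    simp only [add_mul, mul_add, mul_sub, sub_mul, mul_one, one_mul, this, h', hae, hee]
    abel
  · have : x * e * a = e := by rw [mul_assoc, hx, ← hpq]
    have h' : x * e * e = x * e := by rw [mul_assoc, hee]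
    simp only [add_mul, mul_add, mul_sub, sub_mul, mul_one, one_mul, this, h', hx, hee]
    abel
  · simp [mul_add, mul_sub, hx, hee]

theorem IsVNRegularRing.eq_zero_of_mem_Delta [IsReduced R] (h : IsVNRegularRing R) {d : R}
    (hd : d ∈ Delta R) : d = 0 := by
  obtain ⟨e, v, he, rfl⟩ := h.exists_isIdempotentElem_mul_units d
  have hm := mul_units_mem_Delta hd v⁻¹
  rw [Units.mul_inv_cancel_right] at hm
  rw [eq_zero_of_isIdempotentElem_of_mem_Delta he hm, zero_mul]

theorem IsVNRegularRing.pow_succ_eq_self [IsReduced R] (h : IsVNRegularRing R) {k : ℕ}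
    (hk : IsNDeltaU R k) (a : R) : a ^ (k + 1) = a := by
  obtain ⟨e, v, he, rfl⟩ := h.exists_isIdempotentElem_mul_units a
  rw [(he.commute_of_isReduced (v : R)).mul_pow, he.pow_succ_eq, pow_succ,
    sub_eq_zero.1 (h.eq_zero_of_mem_Delta (hk v)), one_mul]

theorem isNDeltaU_of_pow_succ_eq_self {k : ℕ} (h : ∀ x : R, x ^ (k + 1) = x) :
    IsNDeltaU R k := by
  intro u
  have hu : (u : R) ^ k = 1 := by
    have := h u
    rw [pow_succ] at this
    exact u.isUnit.mul_right_cancel (this.trans (one_mul _).symm)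
  rw [hu, sub_self]
  exact (deltaAddSubgroup R).zero_mem

theorem isVNRegularRing_of_pow_eq_self {m : ℕ} (h : ∀ x : R, x ^ (m + 2) = x) :
    IsVNRegularRing R :=
  fun a => ⟨a ^ m, by rw [← pow_succ', ← pow_succ, h]⟩

theorem IsVNRegularRing.isPiRegularRing (h : IsVNRegularRing R) : IsPiRegularRing R :=
  fun a => ⟨1, le_rfl, by simpa using h a⟩

end Ring

/-- For a ring `R` and `n ≥ 1`, the following are equivalent:
(i) `R` is regular and `(2n-1)`-ΔU; (ii) `R` is π-regular, reduced and `(2n-1)`-ΔU;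
(iii) `R` satisfies the identity `x ^ (2n) = x`. -/
theorem regular_isNDeltaU_tfae (R : Type*) [Ring R] (n : ℕ) (hn : 1 ≤ n) :
    List.TFAE
      [IsVNRegularRing R ∧ IsNDeltaU R (2 * n - 1),
       IsPiRegularRing R ∧ IsReduced R ∧ IsNDeltaU R (2 * n - 1),
       ∀ x : R, x ^ (2 * n) = x] := by
  obtain ⟨j, rfl⟩ : ∃ j, n = j + 1 := ⟨n - 1, by omega⟩
  rw [show 2 * (j + 1) - 1 = 2 * j + 1 by omega, show 2 * (j + 1) = 2 * j + 1 + 1 by omega]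
  tfae_have 1 → 2 := fun ⟨hR, hU⟩ => ⟨hR.isPiRegularRing, hR.isReduced hU, hU⟩
  tfae_have 2 → 3 := fun ⟨hR, _, hU⟩ => hR.isVNRegularRing.pow_succ_eq_self hU
  tfae_have 3 → 1 := fun h =>
    ⟨isVNRegularRing_of_pow_eq_self h, isNDeltaU_of_pow_succ_eq_self h⟩
  tfae_finish
end
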